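/- Let (Y_n)_{n∈ℤ} be a strictly stationary real-valued stochastic process whose α-mixing coefficients α_n satisfy α_n ≤ C ζ^n for some C ≥ 0 and ζ ∈ (0,1). Let φ : ℝ → ℝ be measurable with E(φ(Y_1)) = 0 and E|φ(Y_1)|^s < ∞ for some s > 2. Then Σ_{k=1}^{∞} |E(φ(Y_1) φ(Y_{1+k}))| < ∞. -/

import Mathlib

open MeasureTheory ProbabilityTheory Filter Topology

/-- The σ-algebra `M_s` generated by the coordinates `Y k`, `k ∈ s`, of a real-valued
process indexed by `ℤ`. -/
def sigmaGen {Ω : Type*} [MeasurableSpace Ω] (Y : ℤ → Ω → ℝ) (s : Set ℤ) :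
    MeasurableSpace Ω :=
  ⨆ k ∈ s, MeasurableSpace.comap (Y k) (borel ℝ)

/-- The α-mixing coefficient
`α_n = sup {|P(A∩B) − P(A)P(B)| : A ∈ M_{-∞}^0, B ∈ M_n^∞}` of a real-valued process
indexed by `ℤ`. -/
noncomputable def alphaMixingCoef {Ω : Type*} [MeasurableSpace Ω] (P : Measure Ω)
    (Y : ℤ → Ω → ℝ) (n : ℕ) : ℝ :=
  sSup {x : ℝ | ∃ A B : Set Ω,
    MeasurableSet[sigmaGen Y {k : ℤ | k ≤ 0}] A ∧
    MeasurableSet[sigmaGen Y {k : ℤ | (n : ℤ) ≤ k}] B ∧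
    x = |(P (A ∩ B)).toReal - (P A).toReal * (P B).toReal|}

/-- A real-valued process indexed by `ℤ` is strictly stationary if all its
finite-dimensional distributions are invariant under time shifts. -/
def StrictlyStationary {Ω : Type*} [MeasurableSpace Ω] (P : Measure Ω)
    (Y : ℤ → Ω → ℝ) : Prop :=
  ∀ (h : ℤ) (r : ℕ) (k : Fin r → ℤ),
    Measure.map (fun ω (i : Fin r) => Y (k i + h) ω) P
      = Measure.map (fun ω (i : Fin r) => Y (k i) ω) P

/-- If the integral of `F` over every `m`-measurable set is at most `c` in absolute value, then
integrating `F` against an `m`-measurable function bounded by `N` gives at most `2 * c * N`. -/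
theorem abs_integral_mul_le_of_abs_setIntegral_le {Ω : Type*} {m m0 : MeasurableSpace Ω}
    (hm : m ≤ m0) {P : Measure[m0] Ω} [IsProbabilityMeasure P] {F Z : Ω → ℝ} {N c : ℝ}
    (hF : Integrable F P) (hZ : StronglyMeasurable[m] Z) (hN : ∀ ω, |Z ω| ≤ N)
    (hc : ∀ B, MeasurableSet[m] B → |∫ ω in B, F ω ∂P| ≤ c) :
    |∫ ω, Z ω * F ω ∂P| ≤ N * (2 * c) := by
  obtain ⟨ω₀⟩ := nonempty_of_isProbabilityMeasure P
  have hN0 : 0 ≤ N := (abs_nonneg _).trans (hN ω₀)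
  set h : Ω → ℝ := P[F|m]
  have hh_int : Integrable h P := integrable_condExp
  have hh_meas : StronglyMeasurable[m] h := stronglyMeasurable_condExp
  have hZF : Integrable (fun ω => Z ω * F ω) P :=
    hF.bdd_mul (hZ.mono hm).aestronglyMeasurable (ae_of_all _ hN)
  have hZh : Integrable (fun ω => Z ω * h ω) P :=
    hh_int.bdd_mul (hZ.mono hm).aestronglyMeasurable (ae_of_all _ hN)
  have hpull : ∫ ω, Z ω * F ω ∂P = ∫ ω, Z ω * h ω ∂P := by
    rw [← integral_condExp hm]
    exact integral_congr_ae (condExp_mul_of_stronglyMeasurable_left hZ hZF hF)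
  have hset : MeasurableSet[m] {ω | 0 ≤ h ω} :=
    hh_meas.measurable measurableSet_Ici
  have habs : ∫ ω, |h ω| ∂P ≤ 2 * c := by
    have hpos : ∫ ω in {ω | 0 ≤ h ω}, |h ω| ∂P = ∫ ω in {ω | 0 ≤ h ω}, F ω ∂P := by
      rw [← setIntegral_condExp hm hF hset]
      exact setIntegral_congr_fun (hm _ hset) fun ω hω => abs_of_nonneg hω
    have hneg : ∫ ω in {ω | 0 ≤ h ω}ᶜ, |h ω| ∂P = -∫ ω in {ω | 0 ≤ h ω}ᶜ, F ω ∂P := by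
      rw [← setIntegral_condExp hm hF hset.compl, ← integral_neg]
      exact setIntegral_congr_fun (hm _ hset.compl) fun ω hω => abs_of_neg (not_le.mp hω)
    rw [← integral_add_compl (hm _ hset) hh_int.abs, hpos, hneg]
    linarith [(abs_le.mp (hc _ hset)).2, (abs_le.mp (hc _ hset.compl)).1]
  calc |∫ ω, Z ω * F ω ∂P| = |∫ ω, Z ω * h ω ∂P| := by rw [hpull]
    _ ≤ ∫ ω, |Z ω * h ω| ∂P := abs_integral_le_integral_abs
    _ ≤ ∫ ω, N * |h ω| ∂P := by
      refine integral_mono hZh.abs (hh_int.abs.const_mul N) fun ω => ?_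
      simp only [abs_mul]
      exact mul_le_mul_of_nonneg_right (hN ω) (abs_nonneg _)
    _ = N * ∫ ω, |h ω| ∂P := integral_const_mul _ _
    _ ≤ N * (2 * c) := mul_le_mul_of_nonneg_left habs hN0

/-- Covariance inequality for bounded random variables measurable with respect to two
σ-algebras whose α-mixing coefficient is at most `a`. -/
theorem abs_integral_mul_sub_le_of_bounded {Ω : Type*} {m₁ m₂ m0 : MeasurableSpace Ω}
    (hm₁ : m₁ ≤ m0) (hm₂ : m₂ ≤ m0) {P : Measure[m0] Ω} [IsProbabilityMeasure P]
    {X Z : Ω → ℝ} {M N a : ℝ}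
    (hX : StronglyMeasurable[m₁] X) (hZ : StronglyMeasurable[m₂] Z)
    (hM : ∀ ω, |X ω| ≤ M) (hN : ∀ ω, |Z ω| ≤ N)
    (ha : ∀ A B, MeasurableSet[m₁] A → MeasurableSet[m₂] B →
      |P.real (A ∩ B) - P.real A * P.real B| ≤ a) :
    |∫ ω, X ω * Z ω ∂P - (∫ ω, X ω ∂P) * ∫ ω, Z ω ∂P| ≤ 4 * a * (M * N) := by
  have hXi : Integrable X P :=
    Integrable.of_bound (hX.mono hm₁).aestronglyMeasurable M (ae_of_all _ hM)
  have hZi : Integrable Z P :=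
    Integrable.of_bound (hZ.mono hm₂).aestronglyMeasurable N (ae_of_all _ hN)
  have hXZ : Integrable (fun ω => Z ω * X ω) P :=
    hXi.bdd_mul (hZ.mono hm₂).aestronglyMeasurable (ae_of_all _ hN)
  have hstep : ∀ B, MeasurableSet[m₂] B →
      |∫ ω in B, (X ω - ∫ ω', X ω' ∂P) ∂P| ≤ M * (2 * a) := by
    intro B hB
    have hB0 := hm₂ _ hB
    have hind : Integrable (B.indicator fun _ => (1 : ℝ)) P :=
      (integrable_const 1).indicator hB0
    have hXB : Integrable (fun ω => X ω * B.indicator (fun _ => (1 : ℝ)) ω) P :=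
      hind.bdd_mul (hX.mono hm₁).aestronglyMeasurable (ae_of_all _ hM)
    have hF : Integrable (fun ω => B.indicator (fun _ => (1 : ℝ)) ω - P.real B) P :=
      hind.sub (integrable_const _)
    have hcov := abs_integral_mul_le_of_abs_setIntegral_le hm₁ hF hX hM (c := a) (by
      intro A hA
      have hA0 := hm₁ _ hA
      rw [integral_sub hind.integrableOn (integrable_const _).integrableOn,
        setIntegral_indicator hB0]
      simpa [mul_comm] using ha A B hA hB)
    have heq : ∫ ω in B, (X ω - ∫ ω', X ω' ∂P) ∂P
        = ∫ ω, X ω * (B.indicator (fun _ => (1 : ℝ)) ω - P.real B) ∂P := by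
      have h₁ : ∫ ω, X ω * B.indicator (fun _ => (1 : ℝ)) ω ∂P = ∫ ω in B, X ω ∂P := by
        rw [← integral_indicator hB0]
        congr 1 with ω
        by_cases hω : ω ∈ B <;> simp [hω]
      simp only [mul_sub]
      rw [integral_sub hXB (hXi.mul_const _), integral_mul_const, h₁,
        integral_sub hXi.integrableOn (integrable_const _).integrableOn]
      simp [mul_comm]
    rw [heq]
    exact hcov
  have hcov := abs_integral_mul_le_of_abs_setIntegral_le hm₂ (hXi.sub (integrable_const _))
    hZ hN hstep
  have heq : ∫ ω, Z ω * (X ω - ∫ ω', X ω' ∂P) ∂P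
      = ∫ ω, X ω * Z ω ∂P - (∫ ω, X ω ∂P) * ∫ ω, Z ω ∂P := by
    simp only [mul_sub]
    rw [integral_sub hXZ (hZi.mul_const _), integral_mul_const, mul_comm (∫ ω, Z ω ∂P)]
    simp only [mul_comm]
  simp only [Pi.sub_apply] at hcov
  rw [heq] at hcov
  linarith

/-- Covariance inequality for centred random variables with a moment of order `s > 2`, in terms
of a truncation level `M`. -/
theorem abs_integral_mul_le_of_moment {Ω : Type*} {m₁ m₂ m0 : MeasurableSpace Ω}
    (hm₁ : m₁ ≤ m0) (hm₂ : m₂ ≤ m0) {P : Measure[m0] Ω} [IsProbabilityMeasure P]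
    {X Z : Ω → ℝ} {M a s : ℝ} (hs : 2 < s) (hM : 0 < M)
    (hX : Measurable[m₁] X) (hZ : Measurable[m₂] Z)
    (hXs : Integrable (fun ω => |X ω| ^ s) P) (hZs : Integrable (fun ω => |Z ω| ^ s) P)
    (hX0 : ∫ ω, X ω ∂P = 0)
    (ha : ∀ A B, MeasurableSet[m₁] A → MeasurableSet[m₂] B →
      |P.real (A ∩ B) - P.real A * P.real B| ≤ a) :
    |∫ ω, X ω * Z ω ∂P| ≤ 4 * a * M ^ 2 +
      M ^ (2 - s) * (2 * ∫ ω, |X ω| ^ s ∂P + ∫ ω, |Z ω| ^ s ∂P) := by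
  set T : ℝ → ℝ := fun x => if |x| ≤ M then x else 0 with hT
  have hTm : Measurable T :=
    Measurable.ite (measurableSet_le measurable_id.abs measurable_const) measurable_id
      measurable_const
  have hTM : ∀ x, |T x| ≤ M := by
    intro x
    by_cases hx : |x| ≤ M <;> simp [hT, hx, hM.le]
  have hrpow : ∀ t : ℝ, M ≤ t → t ^ 2 ≤ M ^ (2 - s) * t ^ s := by
    intro t ht
    have ht0 : 0 < t := hM.trans_le ht
    calc t ^ 2 = t ^ (2 - s) * t ^ s := by
          rw [← Real.rpow_add ht0, sub_add_cancel, Real.rpow_two]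
      _ ≤ M ^ (2 - s) * t ^ s := mul_le_mul_of_nonneg_right
          (Real.rpow_le_rpow_of_nonpos hM ht (by linarith)) (Real.rpow_nonneg ht0.le _)
  have hM2 : 0 ≤ M ^ (2 - s) := Real.rpow_nonneg hM.le _
  have hprod : ∀ x z : ℝ, M < max |x| |z| →
      |x| * |z| ≤ M ^ (2 - s) * (|x| ^ s + |z| ^ s) := by
    intro x z hxz
    have hmax : |x| * |z| ≤ max |x| |z| ^ 2 := by
      rw [pow_two]
      exact mul_le_mul (le_max_left _ _) (le_max_right _ _) (abs_nonneg _)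
        ((abs_nonneg _).trans (le_max_left _ _))
    refine (hmax.trans (hrpow _ hxz.le)).trans (mul_le_mul_of_nonneg_left ?_ hM2)
    have hx := Real.rpow_nonneg (abs_nonneg x) s
    have hz := Real.rpow_nonneg (abs_nonneg z) s
    rcases max_choice |x| |z| with h | h <;> rw [h] <;> linarith
  have hdiff : ∀ x z : ℝ, |x * z - T x * T z| ≤ M ^ (2 - s) * (|x| ^ s + |z| ^ s) := by
    intro x z
    by_cases hx : |x| ≤ M
    · by_cases hz : |z| ≤ M
      · simp only [hT, hx, hz, if_true, sub_self, abs_zero]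
        positivity
      · simpa [hT, hz, abs_mul] using hprod x z (lt_max_of_lt_right (not_le.mp hz))
    · simpa [hT, hx, abs_mul] using hprod x z (lt_max_of_lt_left (not_le.mp hx))
  have htail : ∀ x : ℝ, M * |x - T x| ≤ M ^ (2 - s) * |x| ^ s := by
    intro x
    by_cases hx : |x| ≤ M
    · simp only [hT, hx, if_true, sub_self, abs_zero, mul_zero]
      positivity
    · have hx' := not_le.mp hx
      simp only [hT, hx, if_false, sub_zero]
      refine le_trans ?_ (hrpow _ hx'.le)
      nlinarith
  have hX' := hX.mono hm₁ le_rfl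
  have hZ' := hZ.mono hm₂ le_rfl
  have hTX : Integrable (fun ω => T (X ω)) P :=
    Integrable.of_bound (hTm.comp hX').aestronglyMeasurable M (ae_of_all _ fun ω => hTM _)
  have hTXZ : Integrable (fun ω => T (X ω) * T (Z ω)) P :=
    (Integrable.of_bound (hTm.comp hZ').aestronglyMeasurable M
      (ae_of_all _ fun ω => hTM _)).bdd_mul (hTm.comp hX').aestronglyMeasurable
        (ae_of_all _ fun ω => hTM _)
  have hsum : Integrable (fun ω => M ^ (2 - s) * (|X ω| ^ s + |Z ω| ^ s)) P :=
    (hXs.add hZs).const_mul _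
  have hR : Integrable (fun ω => X ω * Z ω - T (X ω) * T (Z ω)) P :=
    hsum.mono' ((hX'.mul hZ').sub ((hTm.comp hX').mul (hTm.comp hZ'))).aestronglyMeasurable
      (ae_of_all _ fun ω => hdiff _ _)
  have hXT : Integrable (fun ω => X ω - T (X ω)) P := by
    refine (hXs.const_mul (M⁻¹ * M ^ (2 - s))).mono'
      (hX'.sub (hTm.comp hX')).aestronglyMeasurable (ae_of_all _ fun ω => ?_)
    rw [Real.norm_eq_abs, mul_assoc, le_inv_mul_iff₀ hM]
    exact htail _
  have hXi : Integrable X P := by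
    simpa [Pi.add_def] using hXT.add hTX
  have hR_le : |∫ ω, (X ω * Z ω - T (X ω) * T (Z ω)) ∂P|
      ≤ M ^ (2 - s) * (∫ ω, |X ω| ^ s ∂P + ∫ ω, |Z ω| ^ s ∂P) := by
    rw [← integral_add hXs hZs, ← integral_const_mul]
    exact abs_integral_le_integral_abs.trans
      (integral_mono hR.abs hsum fun ω => hdiff _ _)
  have hcov := abs_integral_mul_sub_le_of_bounded hm₁ hm₂ (hTm.comp hX).stronglyMeasurable
    (hTm.comp hZ).stronglyMeasurable (fun ω => hTM _) (fun ω => hTM _) ha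
  simp only [Function.comp_apply] at hcov
  have hmean : |∫ ω, T (X ω) ∂P| * M ≤ M ^ (2 - s) * ∫ ω, |X ω| ^ s ∂P := by
    have h₁ : |∫ ω, T (X ω) ∂P| = |∫ ω, (X ω - T (X ω)) ∂P| := by
      rw [integral_sub hXi hTX, hX0, zero_sub, abs_neg]
    rw [h₁, mul_comm, ← integral_const_mul]
    refine (mul_le_mul_of_nonneg_left abs_integral_le_integral_abs hM.le).trans ?_
    rw [← integral_const_mul]
    exact integral_mono (hXT.abs.const_mul M) (hXs.const_mul _) fun ω => htail _
  have hTZ : |∫ ω, T (Z ω) ∂P| ≤ M := by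
    simpa using norm_integral_le_of_norm_le_const (μ := P) (f := fun ω => T (Z ω))
      (ae_of_all _ fun ω => hTM (Z ω))
  have hmean2 : |(∫ ω, T (X ω) ∂P) * ∫ ω, T (Z ω) ∂P|
      ≤ M ^ (2 - s) * ∫ ω, |X ω| ^ s ∂P := by
    rw [abs_mul]
    exact (mul_le_mul_of_nonneg_left hTZ (abs_nonneg _)).trans hmean
  have hsplit : ∫ ω, X ω * Z ω ∂P = ∫ ω, (X ω * Z ω - T (X ω) * T (Z ω)) ∂P
      + ∫ ω, T (X ω) * T (Z ω) ∂P := by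
    rw [← integral_add hR hTXZ]
    simp
  rw [abs_le] at hR_le hcov hmean2 ⊢
  constructor <;> nlinarith

theorem abs_measureReal_inter_sub_le_alphaMixingCoef {Ω : Type*} [MeasurableSpace Ω]
    (P : Measure Ω) [IsProbabilityMeasure P] (Y : ℤ → Ω → ℝ) (n : ℕ) {A B : Set Ω}
    (hA : MeasurableSet[MeasurableSpace.comap (Y 0) inferInstance] A)
    (hB : MeasurableSet[MeasurableSpace.comap (Y n) inferInstance] B) :
    |P.real (A ∩ B) - P.real A * P.real B| ≤ alphaMixingCoef P Y n := by
  refine le_csSup ⟨1, ?_⟩ ⟨A, B, ?_, ?_, rfl⟩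
  · rintro x ⟨A, B, -, -, rfl⟩
    change |P.real (A ∩ B) - P.real A * P.real B| ≤ 1
    have h₁ : P.real (A ∩ B) ≤ 1 := measureReal_le_one
    have h₂ : P.real A * P.real B ≤ 1 :=
      mul_le_one₀ measureReal_le_one measureReal_nonneg measureReal_le_one
    have h₃ : 0 ≤ P.real (A ∩ B) := measureReal_nonneg
    have h₄ : 0 ≤ P.real A * P.real B := mul_nonneg measureReal_nonneg measureReal_nonneg
    rw [abs_le]
    constructor <;> linarith
  · exact le_iSup₂_of_le (f := fun k (_ : k ∈ {k : ℤ | k ≤ 0}) =>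
      MeasurableSpace.comap (Y k) (borel ℝ)) 0 (le_refl (0 : ℤ)) le_rfl A hA
  · exact le_iSup₂_of_le (f := fun k (_ : k ∈ {k : ℤ | (n : ℤ) ≤ k}) =>
      MeasurableSpace.comap (Y k) (borel ℝ)) (n : ℤ) (le_refl (n : ℤ)) le_rfl B hB

theorem StrictlyStationary.identDistrib_prodMk {Ω : Type*} [MeasurableSpace Ω] {P : Measure Ω}
    {Y : ℤ → Ω → ℝ} (hstat : StrictlyStationary P Y) (hmeas : ∀ k, Measurable (Y k))
    (a b h : ℤ) :
    IdentDistrib (fun ω => (Y (a + h) ω, Y (b + h) ω)) (fun ω => (Y a ω, Y b ω)) P P := by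
  have hvec : IdentDistrib (fun ω (i : Fin 2) => Y (![a, b] i + h) ω)
      (fun ω (i : Fin 2) => Y (![a, b] i) ω) P P :=
    ⟨(measurable_pi_lambda _ fun _ => hmeas _).aemeasurable,
      (measurable_pi_lambda _ fun _ => hmeas _).aemeasurable, hstat h 2 ![a, b]⟩
  exact hvec.comp (u := fun v : Fin 2 → ℝ => (v 0, v 1))
    ((measurable_pi_apply 0).prodMk (measurable_pi_apply 1))

/-- **Absolute summability of autocovariances (Lemma 1.2 ii) of the paper, finiteness
of the asymptotic variance).** If `(Y_n)` is strictly stationary with geometrically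
decreasing α-mixing coefficients, `E(φ(Y_1)) = 0` and `E|φ(Y_1)|^s < ∞` for some `s > 2`,
then `Σ_{k=1}^∞ |E(φ(Y_1) φ(Y_{1+k}))| < ∞`. -/
theorem summable_autocovariances_of_geometric_alphaMixing
    {Ω : Type*} [MeasurableSpace Ω] (P : Measure Ω) [IsProbabilityMeasure P]
    (Y : ℤ → Ω → ℝ) (hmeas : ∀ k, Measurable (Y k))
    (hstat : StrictlyStationary P Y)
    (C ζ : ℝ) (hC : 0 ≤ C) (hζ0 : 0 < ζ) (hζ1 : ζ < 1)
    (hmix : ∀ n : ℕ, alphaMixingCoef P Y n ≤ C * ζ ^ n)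
    (φ : ℝ → ℝ) (hφ : Measurable φ)
    (hmean : ∫ ω, φ (Y 1 ω) ∂P = 0)
    (hmoment : ∃ s : ℝ, 2 < s ∧ Integrable (fun ω => |φ (Y 1 ω)| ^ s) P) :
    Summable (fun k : ℕ =>
      |∫ ω, φ (Y 1 ω) * φ (Y (1 + ((k : ℤ) + 1)) ω) ∂P|) := by
  obtain ⟨s, hs, hint⟩ := hmoment
  have hpow : Measurable fun x => |φ x| ^ s := hφ.abs.pow_const s
  have hid : ∀ k : ℤ, IdentDistrib (Y k) (Y 1) P P := by
    intro k
    simpa [Function.comp_def] using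
      (hstat.identDistrib_prodMk hmeas 1 1 (k - 1)).comp measurable_fst
  have hintk : ∀ k : ℤ, Integrable (fun ω => |φ (Y k ω)| ^ s) P := fun k =>
    ((hid k).comp hpow).integrable_iff.mpr hint
  have hmomk : ∀ k : ℤ, ∫ ω, |φ (Y k ω)| ^ s ∂P = ∫ ω, |φ (Y 1 ω)| ^ s ∂P := fun k =>
    ((hid k).comp hpow).integral_eq
  have hmean0 : ∫ ω, φ (Y 0 ω) ∂P = 0 := ((hid 0).comp hφ).integral_eq.trans hmean
  set K := ∫ ω, |φ (Y 1 ω)| ^ s ∂P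
  set r : ℝ := ζ ^ (1 / 4 : ℝ) with hr
  have hr0 : 0 < r := Real.rpow_pos_of_pos hζ0 _
  have hr1 : r < 1 := Real.rpow_lt_one hζ0.le hζ1 (by norm_num)
  have hr4 : r ^ 4 = ζ := by
    rw [hr, ← Real.rpow_natCast, ← Real.rpow_mul hζ0.le]
    norm_num
  have hbound : ∀ k : ℕ, |∫ ω, φ (Y 1 ω) * φ (Y (1 + ((k : ℤ) + 1)) ω) ∂P|
      ≤ 4 * C * (r ^ 2) ^ (k + 1) + 3 * K * (r ^ (s - 2)) ^ (k + 1) := by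
    intro k
    have hshift : ∫ ω, φ (Y 1 ω) * φ (Y (1 + ((k : ℤ) + 1)) ω) ∂P
        = ∫ ω, φ (Y 0 ω) * φ (Y ((k + 1 : ℕ) : ℤ) ω) ∂P := by
      have h := ((hstat.identDistrib_prodMk hmeas 0 ((k + 1 : ℕ) : ℤ) 1).comp
        (u := fun p : ℝ × ℝ => φ p.1 * φ p.2)
        ((hφ.comp measurable_fst).mul (hφ.comp measurable_snd))).integral_eq
      simpa [Function.comp_def, add_comm, add_left_comm] using h
    have hcov := abs_integral_mul_le_of_moment (hmeas 0).comap_le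
      (hmeas ((k + 1 : ℕ) : ℤ)).comap_le hs (inv_pos.mpr (pow_pos hr0 (k + 1)))
      (hφ.comp (comap_measurable (Y 0))) (hφ.comp (comap_measurable (Y ((k + 1 : ℕ) : ℤ))))
      (hintk 0) (hintk _) hmean0 fun A B hA hB =>
        (abs_measureReal_inter_sub_le_alphaMixingCoef P Y (k + 1) hA hB).trans (hmix (k + 1))
    have hr_rpow : ((r ^ (k + 1))⁻¹) ^ (2 - s) = (r ^ (s - 2)) ^ (k + 1) := by
      rw [Real.inv_rpow (pow_nonneg hr0.le _), ← Real.rpow_neg (pow_nonneg hr0.le _), neg_sub,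
        ← Real.rpow_natCast, ← Real.rpow_natCast, ← Real.rpow_mul hr0.le,
        ← Real.rpow_mul hr0.le, mul_comm]
    have hζr : ζ ^ (k + 1) * ((r ^ (k + 1))⁻¹) ^ 2 = (r ^ 2) ^ (k + 1) := by
      rw [← hr4]
      field_simp
      ring
    simp only [Function.comp_apply, hmomk, hr_rpow] at hcov
    rw [hshift]
    calc _ ≤ _ := hcov
      _ = 4 * C * (ζ ^ (k + 1) * ((r ^ (k + 1))⁻¹) ^ 2)
          + 3 * K * (r ^ (s - 2)) ^ (k + 1) := by ring
      _ = _ := by rw [hζr]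
  refine Summable.of_nonneg_of_le (fun _ => abs_nonneg _) hbound (Summable.add ?_ ?_)
  · exact ((summable_nat_add_iff 1).mpr (summable_geometric_of_lt_one (by positivity)
      (pow_lt_one₀ hr0.le hr1 two_ne_zero))).mul_left _
  · exact ((summable_nat_add_iff 1).mpr (summable_geometric_of_lt_one
      (Real.rpow_nonneg hr0.le _) (Real.rpow_lt_one hr0.le hr1 (by linarith)))).mul_left _
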